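/- Let (G_k)_{k≥1} be a sequence of finite simple connected vertex-transitive (q+1)-regular graphs with ν_k = |V(G_k)| → ∞, and suppose the empirical spectral measures μ_k = (1/ν_k)·∑_{λ ∈ Spec(P(G_k))} δ_λ (eigenvalues counted with multiplicity) converge weakly to a probability measure μ_P on [−1,1]. Let a ∈ [0,1], b ∈ ℝ, η = (1−q)a + b(q+1), σ = b((1−q)a + bq). Then for every real u with |bu| < 1 and (1 + σu²) − ηut > 0 for all t ∈ [−1,1], lim_{k→∞} det(I − u·Ũ(G_k))^{1/ν_k} = (1 − b²u²)^{(q−1)/2} · exp[ ∫ log( (1 + σu²) − ηuλ ) dμ_P(λ) ]. -/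

import Mathlib

open Matrix BigOperators Filter MeasureTheory

/-- The generalized Grover matrix `Ũ` of a graph `G` (real parameters `a`, `b`). -/
noncomputable def gGroverMatrix {V : Type*} [Fintype V] [DecidableEq V] (G : SimpleGraph V)
    [DecidableRel G.Adj] (a b : ℝ) : Matrix G.Dart G.Dart ℝ :=
  fun e f =>
    if f = e.symm then (2 / (G.degree f.snd : ℝ) - 1) * a
    else if f.snd = e.fst then (2 / (G.degree f.snd : ℝ) - 1) * a + b
    else 0

/-- The transition probability matrix of the simple random walk on `G`. -/
noncomputable def transMatrix {V : Type*} [Fintype V] [DecidableEq V] (G : SimpleGraph V)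
    [DecidableRel G.Adj] : Matrix V V ℝ :=
  fun u v => if G.Adj u v then 1 / (G.degree u : ℝ) else 0

section DartMatrices

variable {V : Type*} [Fintype V] [DecidableEq V] (G : SimpleGraph V) [DecidableRel G.Adj]

/-- The permutation matrix of arc reversal. -/
noncomputable def dartFlip : Matrix G.Dart G.Dart ℝ :=
  fun e f => if f = e.symm then 1 else 0

/-- The incidence matrix between arcs and their origins. -/
noncomputable def dartOrigin : Matrix G.Dart V ℝ :=
  fun e v => if e.fst = v then 1 else 0

/-- The incidence matrix between arcs and their termini. -/
noncomputable def dartTerminus : Matrix G.Dart V ℝ :=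
  fun e v => if e.snd = v then 1 else 0

lemma dartFlip_mul_self : dartFlip G * dartFlip G = 1 := by
  ext e f
  rw [Matrix.mul_apply, Finset.sum_eq_single e.symm (by simp +contextual [dartFlip]) (by simp)]
  simp [dartFlip, Matrix.one_apply, eq_comm]

lemma dartFlip_mul_dartOrigin : dartFlip G * dartOrigin G = dartTerminus G := by
  ext e v
  rw [Matrix.mul_apply, Finset.sum_eq_single e.symm (by simp +contextual [dartFlip]) (by simp)]
  simp [dartFlip, dartOrigin, dartTerminus]

lemma dartTerminus_transpose_mul_dartOrigin :
    (dartTerminus G)ᵀ * dartOrigin G = G.adjMatrix ℝ := by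
  ext v w
  simp only [dartTerminus, dartOrigin, Matrix.mul_apply, Matrix.transpose_apply,
    SimpleGraph.adjMatrix_apply, ite_mul, one_mul, zero_mul, ← ite_and]
  by_cases h : G.Adj v w
  · rw [Finset.sum_eq_single (⟨(w, v), h.symm⟩ : G.Dart)]
    · simp [h]
    · intro e _ he
      rw [if_neg]
      rintro ⟨rfl, rfl⟩
      exact he rfl
    · simp
  · rw [if_neg h]
    refine Finset.sum_eq_zero fun e _ => if_neg ?_
    rintro ⟨rfl, rfl⟩
    exact h e.adj.symm

lemma dartTerminus_transpose_mul_self :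
    (dartTerminus G)ᵀ * dartTerminus G = Matrix.diagonal fun v => (G.degree v : ℝ) := by
  ext v w
  simp only [dartTerminus, Matrix.mul_apply, Matrix.transpose_apply, ite_mul, one_mul, zero_mul,
    ← ite_and]
  rcases eq_or_ne v w with rfl | h
  · rw [Matrix.diagonal_apply_eq, ← G.dart_fst_fiber_card_eq_degree v,
      ← Equiv.sum_comp (SimpleGraph.Dart.symm_involutive (G := G)).toPerm]
    simp
  · rw [Matrix.diagonal_apply_ne _ h]
    refine Finset.sum_eq_zero fun e _ => if_neg ?_
    rintro ⟨rfl, rfl⟩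
    exact h rfl

lemma one_add_mul_one_sub_dartFlip (t : ℝ) :
    (1 + t • dartFlip G) * (1 - t • dartFlip G) = (1 - t ^ 2) • (1 : Matrix G.Dart G.Dart ℝ) := by
  simp only [add_mul, mul_sub, one_mul, mul_one, Matrix.smul_mul, Matrix.mul_smul, smul_smul,
    dartFlip_mul_self, sub_smul, one_smul, pow_two]
  abel

lemma det_one_sub_smul_dartFlip (t : ℝ) :
    (1 - t • dartFlip G).det = (1 + t • dartFlip G).det := by
  let r := Fintype.equivFin V
  let d : G.Dart → ℝ := fun e => if r e.fst < r e.snd then 1 else -1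
  have hd : ∀ e, d e * d e = 1 := fun e => by simp only [d]; split_ifs <;> norm_num
  have hds : ∀ e : G.Dart, d e * d e.symm = -1 := fun e => by
    have hne : r e.fst ≠ r e.snd := fun h => e.fst_ne_snd (r.injective h)
    rcases hne.lt_or_gt with h | h <;> simp [d, h, h.not_gt]
  have hD : Matrix.diagonal d * Matrix.diagonal d = 1 := by
    rw [Matrix.diagonal_mul_diagonal, ← Matrix.diagonal_one]
    exact congrArg _ (funext hd)
  have hconj : Matrix.diagonal d * (1 + t • dartFlip G) * Matrix.diagonal d
      = 1 - t • dartFlip G := by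
    rw [mul_add, add_mul, mul_one, hD, sub_eq_add_neg]
    congr 1
    ext e f
    rw [Matrix.mul_diagonal, Matrix.diagonal_mul]
    by_cases h : f = e.symm
    · subst h
      simp only [dartFlip, Matrix.smul_apply, Matrix.neg_apply, smul_eq_mul, if_true]
      linear_combination t * hds e
    · simp [dartFlip, h]
  have hdet := congrArg Matrix.det hD
  rw [Matrix.det_mul, Matrix.det_one] at hdet
  rw [← hconj, Matrix.det_mul, Matrix.det_mul]
  linear_combination (1 + t • dartFlip G).det * hdet

lemma det_one_add_smul_dartFlip_nonneg {t : ℝ} (ht : |t| < 1) :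
    0 ≤ (1 + t • dartFlip G).det := by
  obtain ⟨h1, h2⟩ := abs_lt.1 ht
  have hp := Real.mul_self_sqrt (show 0 ≤ 1 + t by linarith)
  have hm := Real.mul_self_sqrt (show 0 ≤ 1 - t by linarith)
  set p := √(1 + t)
  set m := √(1 - t)
  have hsq : 1 + t • dartFlip G
      = (((p + m) / 2) • 1 + ((p - m) / 2) • dartFlip G) *
        (((p + m) / 2) • 1 + ((p - m) / 2) • dartFlip G) := by
    simp only [add_mul, mul_add, mul_one, one_mul, Matrix.smul_mul, Matrix.mul_smul, smul_smul,
      dartFlip_mul_self]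
    have e1 : (1 : ℝ) = (p + m) / 2 * ((p + m) / 2) + (p - m) / 2 * ((p - m) / 2) := by
      linear_combination (-1 / 2) * hp - (1 / 2) * hm
    have e2 : t = (p - m) / 2 * ((p + m) / 2) + (p + m) / 2 * ((p - m) / 2) := by
      linear_combination (-1 / 2) * hp + (1 / 2) * hm
    nth_rewrite 1 [e2]
    rw [← one_smul ℝ (1 : Matrix G.Dart G.Dart ℝ)]
    nth_rewrite 1 [e1]
    module
  rw [hsq, Matrix.det_mul]
  exact mul_self_nonneg _

lemma det_one_add_smul_dartFlip {t : ℝ} (ht : |t| < 1) :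
    (1 + t • dartFlip G).det = (1 - t ^ 2) ^ ((Fintype.card G.Dart : ℝ) / 2) := by
  have hs : 0 ≤ 1 - t ^ 2 := by
    have := (sq_lt_one_iff_abs_lt_one t).2 ht
    linarith
  have h := congrArg Matrix.det (one_add_mul_one_sub_dartFlip G t)
  rw [Matrix.det_mul, det_one_sub_smul_dartFlip, Matrix.det_smul, Matrix.det_one, mul_one] at h
  rw [div_eq_mul_inv, Real.rpow_mul hs, Real.rpow_natCast, ← h, ← one_div, ← Real.sqrt_eq_rpow,
    Real.sqrt_mul_self (det_one_add_smul_dartFlip_nonneg G ht)]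

variable {G} {q : ℕ}

lemma adjMatrix_eq_smul_transMatrix (hreg : G.IsRegularOfDegree (q + 1)) :
    G.adjMatrix ℝ = ((q : ℝ) + 1) • transMatrix G := by
  have hq : (q : ℝ) + 1 ≠ 0 := by positivity
  ext v w
  by_cases h : G.Adj v w <;> simp [transMatrix, hreg.degree_eq, h, hq]

lemma gGroverMatrix_eq (hreg : G.IsRegularOfDegree (q + 1)) (a b : ℝ) :
    gGroverMatrix G a b
      = ((2 / ((q : ℝ) + 1) - 1) * a + b) • (dartOrigin G * (dartTerminus G)ᵀ)
        - b • dartFlip G := by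
  ext e f
  by_cases h : f = e.symm
  · subst h
    simp [gGroverMatrix, dartFlip, dartOrigin, dartTerminus, Matrix.mul_apply, hreg.degree_eq]
  · simp [gGroverMatrix, dartFlip, dartOrigin, dartTerminus, Matrix.mul_apply, hreg.degree_eq, h,
      eq_comm (a := e.fst)]

/-- The determinant formula of Ihara–Bass type for the generalized Grover matrix of a regular
graph. -/
lemma det_one_sub_smul_gGroverMatrix (hreg : G.IsRegularOfDegree (q + 1)) {a b u η σ : ℝ}
    (hη : η = (1 - (q : ℝ)) * a + b * ((q : ℝ) + 1))
    (hσ : σ = b * ((1 - (q : ℝ)) * a + b * (q : ℝ))) (hbu : |b * u| < 1) :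
    (1 - u • gGroverMatrix G a b).det
      = (1 - b ^ 2 * u ^ 2) ^ ((Fintype.card V : ℝ) * (((q : ℝ) - 1) / 2)) *
        ((1 + σ * u ^ 2) • (1 : Matrix V V ℝ) - (η * u) • transMatrix G).det := by
  have hq : (q : ℝ) + 1 ≠ 0 := by positivity
  set t := b * u with ht
  have hs : 0 < 1 - t ^ 2 := by
    have := (sq_lt_one_iff_abs_lt_one t).2 hbu
    linarith
  set c := (2 / ((q : ℝ) + 1) - 1) * a + b with hc
  have hcη : c * (q + 1) = η := by
    rw [hη, hc]
    field_simp
    ring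
  have hfac : 1 - u • gGroverMatrix G a b
      = (1 + t • dartFlip G) *
        (1 - ((u * c / (1 - t ^ 2)) • ((1 - t • dartFlip G) * dartOrigin G)) *
          (dartTerminus G)ᵀ) := by
    rw [mul_sub, mul_one, Matrix.smul_mul, Matrix.mul_smul, ← Matrix.mul_assoc,
      ← Matrix.mul_assoc, one_add_mul_one_sub_dartFlip, Matrix.smul_mul, Matrix.smul_mul, smul_smul,
      div_mul_cancel₀ _ hs.ne', Matrix.one_mul, gGroverMatrix_eq hreg, ht]
    module
  have hinner : (1 : Matrix V V ℝ) - (dartTerminus G)ᵀ *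
        ((u * c / (1 - t ^ 2)) • ((1 - t • dartFlip G) * dartOrigin G))
      = (1 - t ^ 2)⁻¹ • ((1 + σ * u ^ 2) • (1 : Matrix V V ℝ) - (η * u) • transMatrix G) := by
    have hdeg : (Matrix.diagonal fun v => (G.degree v : ℝ))
        = ((q : ℝ) + 1) • (1 : Matrix V V ℝ) := by
      ext v w
      rcases eq_or_ne v w with rfl | h
      · simp [hreg.degree_eq]
      · simp [h]
    rw [Matrix.mul_smul, Matrix.sub_mul, Matrix.one_mul, Matrix.smul_mul, dartFlip_mul_dartOrigin,
      Matrix.mul_sub, Matrix.mul_smul, dartTerminus_transpose_mul_dartOrigin,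
      dartTerminus_transpose_mul_self, hdeg, adjMatrix_eq_smul_transMatrix hreg]
    have h1 : 1 + σ * u ^ 2 = (1 - t ^ 2) + t * (u * c * (q + 1)) := by
      rw [mul_assoc u, hcη, hη, hσ, ht]
      ring
    rw [h1, ← hcη]
    ext v w
    simp only [Matrix.sub_apply, Matrix.smul_apply, smul_eq_mul]
    field_simp
    ring
  have hcard : (Fintype.card G.Dart : ℝ) = Fintype.card V * (q + 1) := by
    rw [G.dart_card_eq_sum_degrees]
    simp [hreg.degree_eq]
  rw [hfac, Matrix.det_mul, Matrix.det_one_sub_mul_comm, hinner, Matrix.det_smul,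
    det_one_add_smul_dartFlip G hbu, hcard, ← mul_assoc, inv_pow,
    ← Real.rpow_natCast _ (Fintype.card V),
    ← Real.rpow_neg hs.le, ← Real.rpow_add hs, ht, mul_pow]
  congr 2
  ring

lemma isHermitian_transMatrix (hreg : G.IsRegularOfDegree (q + 1)) :
    (transMatrix G).IsHermitian := by
  ext v w
  simp [transMatrix, hreg.degree_eq, G.adj_comm]

lemma mem_Icc_of_hasEigenvalue_transMatrix (hreg : G.IsRegularOfDegree (q + 1)) {l : ℝ}
    (hl : Module.End.HasEigenvalue (Matrix.toLin' (transMatrix G)) l) :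
    l ∈ Set.Icc (-1 : ℝ) 1 := by
  have hq : (q : ℝ) + 1 ≠ 0 := by positivity
  obtain ⟨v, hv⟩ := eigenvalue_mem_ball hl
  have hrow : ∑ w ∈ Finset.univ.erase v, ‖transMatrix G v w‖ ≤ 1 := by
    refine (Finset.sum_le_sum_of_subset_of_nonneg (Finset.subset_univ _)
      fun _ _ _ => norm_nonneg _).trans_eq ?_
    have hcongr : ∀ w, ‖transMatrix G v w‖ = if G.Adj v w then ((q : ℝ) + 1)⁻¹ else 0 := by
      intro w
      have : (0 : ℝ) < q + 1 := by positivity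
      by_cases h : G.Adj v w <;> simp [transMatrix, hreg.degree_eq, h, abs_of_pos this]
    simp_rw [hcongr]
    rw [← Finset.sum_filter, Finset.sum_const, ← G.neighborFinset_eq_filter,
      G.card_neighborFinset_eq_degree, hreg.degree_eq]
    simp [hq]
  have hdiag : transMatrix G v v = 0 := by simp [transMatrix]
  rw [hdiag, mem_closedBall_zero_iff, Real.norm_eq_abs] at hv
  exact abs_le.1 (hv.trans hrow)

end DartMatrices

lemma Matrix.IsHermitian.det_smul_one_sub_smul {n : Type*} [Fintype n] [DecidableEq n]
    {A : Matrix n n ℝ} (hA : A.IsHermitian) (x y : ℝ) :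
    (y • (1 : Matrix n n ℝ) - x • A).det = ∏ i, (y - x * hA.eigenvalues i) := by
  rcases eq_or_ne x 0 with rfl | hx
  · simp
  · have h : y • (1 : Matrix n n ℝ) - x • A = x • (Matrix.scalar n (y / x) - A) := by
      rw [Matrix.scalar_apply, ← Matrix.smul_one_eq_diagonal, smul_sub, smul_smul,
        mul_div_cancel₀ _ hx]
    rw [h, Matrix.det_smul, ← Matrix.eval_charpoly, hA.charpoly_eq, Polynomial.eval_prod,
      ← Finset.card_univ, ← Finset.prod_const, ← Finset.prod_mul_distrib]
    refine Finset.prod_congr rfl fun i _ => ?_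
    simp
    field_simp

/-- A function continuous on `[-1, 1]` agrees there with a bounded continuous function on `ℝ`. -/
lemma exists_boundedContinuousFunction_eqOn_Icc {f : ℝ → ℝ}
    (hf : ContinuousOn f (Set.Icc (-1) 1)) :
    ∃ g : BoundedContinuousFunction ℝ ℝ, Set.EqOn g f (Set.Icc (-1) 1) := by
  have hle : (-1 : ℝ) ≤ 1 := by norm_num
  refine ⟨(BoundedContinuousFunction.mkOfCompact
    ⟨(Set.Icc (-1 : ℝ) 1).domRestrict f, hf.domRestrict⟩).compContinuous
      ⟨Set.projIcc (-1) 1 hle, continuous_projIcc⟩, fun x hx => ?_⟩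
  change f (Set.projIcc (-1) 1 hle x) = f x
  rw [Set.projIcc_of_mem hle hx]

/-- **Generalized Grover/Zeta Correspondence for a family of regular graphs.**
If `(G_k)` is a sequence of finite simple connected vertex-transitive `(q+1)`-regular
graphs with `ν_k = |V(G_k)| → ∞` whose empirical spectral measures of `P(G_k)`
converge weakly to a probability measure `μ_P` on `[-1,1]`, then for suitable real `u`,
`det(I - u Ũ(G_k))^(1/ν_k) → (1 - b²u²)^((q-1)/2) · exp(∫ log((1 + σu²) - ηuλ) dμ_P(λ))`. -/
theorem generalized_grover_zeta_limit (q : ℕ) (V : ℕ → Type) [∀ k, Fintype (V k)]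
    [∀ k, DecidableEq (V k)] (G : ∀ k, SimpleGraph (V k)) [∀ k, DecidableRel (G k).Adj]
    (hconn : ∀ k, (G k).Connected)
    (hvt : ∀ k, ∀ v w : V k, ∃ φ : G k ≃g G k, φ v = w)
    (hreg : ∀ k, (G k).IsRegularOfDegree (q + 1))
    (hcard : Tendsto (fun k => Fintype.card (V k)) atTop atTop)
    (μP : Measure ℝ) [IsProbabilityMeasure μP]
    (hsupp : μP (Set.Icc (-1 : ℝ) 1)ᶜ = 0)
    (hweak : ∀ f : BoundedContinuousFunction ℝ ℝ,
      Tendsto (fun k =>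
          (1 / (Fintype.card (V k) : ℝ)) *
            (((transMatrix (G k)).charpoly.roots).map (fun lam => f lam)).sum)
        atTop (nhds (∫ lam, f lam ∂μP)))
    (a b : ℝ) (ha : a ∈ Set.Icc (0 : ℝ) 1)
    (η σ : ℝ) (hη : η = (1 - (q : ℝ)) * a + b * ((q : ℝ) + 1))
    (hσ : σ = b * ((1 - (q : ℝ)) * a + b * (q : ℝ)))
    (u : ℝ) (hbu : |b * u| < 1)
    (hpos : ∀ t ∈ Set.Icc (-1 : ℝ) 1, 0 < (1 + σ * u ^ 2) - η * u * t) :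
    Tendsto (fun k =>
        (Matrix.det ((1 : Matrix (G k).Dart (G k).Dart ℝ) - u • gGroverMatrix (G k) a b)) ^
          ((1 : ℝ) / (Fintype.card (V k) : ℝ)))
      atTop
      (nhds ((1 - b ^ 2 * u ^ 2) ^ (((q : ℝ) - 1) / 2) *
        Real.exp (∫ lam, Real.log ((1 + σ * u ^ 2) - η * u * lam) ∂μP))) := by
  set y := 1 + σ * u ^ 2 with hy
  set x := η * u with hx
  have hs : 0 < 1 - b ^ 2 * u ^ 2 := by
    have := (sq_lt_one_iff_abs_lt_one (b * u)).2 hbu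
    rw [mul_pow] at this
    linarith
  obtain ⟨g, hg⟩ := exists_boundedContinuousFunction_eqOn_Icc
    (f := fun l => Real.log (y - x * l))
    (ContinuousOn.log (by fun_prop) fun l hl => (hpos l hl).ne')
  have hint : ∫ l, g l ∂μP = ∫ l, Real.log (y - x * l) ∂μP := by
    refine integral_congr_ae ?_
    have hmem : ∀ᵐ l ∂μP, l ∈ Set.Icc (-1 : ℝ) 1 := hsupp
    filter_upwards [hmem] with l hl using hg hl
  have hlim := ((Real.continuous_exp.tendsto _).comp (hweak g)).const_mul
    ((1 - b ^ 2 * u ^ 2) ^ (((q : ℝ) - 1) / 2))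
  rw [hint] at hlim
  refine hlim.congr fun k => ?_
  have := (hconn k).nonempty
  have hν : (Fintype.card (V k) : ℝ) ≠ 0 := Nat.cast_ne_zero.2 Fintype.card_ne_zero
  have hA := isHermitian_transMatrix (hreg k)
  have hmem : ∀ i, hA.eigenvalues i ∈ Set.Icc (-1 : ℝ) 1 := fun i => by
    refine mem_Icc_of_hasEigenvalue_transMatrix (hreg k) ?_
    rw [Module.End.hasEigenvalue_iff_isRoot_charpoly, Matrix.charpoly_toLin']
    refine Polynomial.isRoot_of_mem_roots ?_
    rw [hA.roots_charpoly_eq_eigenvalues]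
    exact Multiset.mem_map_of_mem _ (Finset.mem_univ i)
  have hprod : ∏ i, (y - x * hA.eigenvalues i)
      = Real.exp (((transMatrix (G k)).charpoly.roots.map fun l => g l).sum) := by
    rw [hA.roots_charpoly_eq_eigenvalues, Multiset.map_map, Finset.sum_map_val, Real.exp_sum]
    refine Finset.prod_congr rfl fun i _ => ?_
    simp [hg (hmem i), Real.exp_log (hpos _ (hmem i))]
  rw [det_one_sub_smul_gGroverMatrix (hreg k) hη hσ hbu, hA.det_smul_one_sub_smul, hprod,
    Real.mul_rpow (Real.rpow_nonneg hs.le _) (Real.exp_pos _).le, ← Real.rpow_mul hs.le,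
    ← Real.exp_mul]
  simp only [Function.comp_apply]
  congr 2
  · field_simp
  · ring
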